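/- Let K be a field, q ∈ K[x_1] nonconstant, R̄ = K[x_1]/⟨q⟩, and fix a monomial ordering on the x̃-monomials. Let F = {f_1,…,f_s} ⊂ R̄[x̃] \ R̄ be nonconstant polynomials all having the same leading monomial lm(f_j) = x̃^α. (i) If f = Σ_{j=1}^s f_j satisfies lm(f) ≺ x̃^α (in particular if f = 0), then there exist nonzero b, b_1,…,b_{s-1} ∈ R̄ with b·f = Σ_{1≤j<s} b_j·S(f_j, f_s). (ii) Moreover, for every irreducible factor p of q, after a permutation of the indices choosing f_s so that the multiplicity of p in ι(lc f_s) is minimal among the multiplicities of p in the ι(lc f_j), the multiplier b in (i) can be chosen so that p does not divide its canonical representative ι(b). -/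

import Mathlib

open MvPolynomial

/-- A monomial ordering on the monomials (exponent vectors) in `m` variables:
a well-ordering compatible with addition of exponents. -/
structure MonomialOrdering (m : ℕ) where
  lin : LinearOrder (Fin m →₀ ℕ)
  wf : WellFounded lin.lt
  add_lt_add : ∀ a b c : Fin m →₀ ℕ, lin.lt a b → lin.lt (a + c) (b + c)

variable {m : ℕ}

open Classical in
/-- Leading monomial of `f` (junk value `0` for `f = 0`). -/
noncomputable def lmon {R : Type*} [CommRing R] (mo : MonomialOrdering m)
    (f : MvPolynomial (Fin m) R) : Fin m →₀ ℕ :=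
  letI := mo.lin
  if h : f = 0 then 0
  else f.support.max' (Finset.nonempty_iff_ne_empty.mpr
    (fun he => h (MvPolynomial.support_eq_empty.mp he)))

/-- Leading coefficient of `f`. -/
noncomputable def lcoeff {R : Type*} [CommRing R] (mo : MonomialOrdering m)
    (f : MvPolynomial (Fin m) R) : R :=
  f.coeff (lmon mo f)

/-- Leading term of `f`, as a polynomial. -/
noncomputable def lterm {R : Type*} [CommRing R] (mo : MonomialOrdering m)
    (f : MvPolynomial (Fin m) R) : MvPolynomial (Fin m) R :=
  MvPolynomial.monomial (lmon mo f) (lcoeff mo f)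

/-- `f` is a nonconstant polynomial, i.e. `f ∉ R`. -/
def Nonconst {R : Type*} [CommRing R] (f : MvPolynomial (Fin m) R) : Prop :=
  ∀ c : R, f ≠ MvPolynomial.C c

theorem lmon_mem_support {R : Type*} [CommRing R] (mo : MonomialOrdering m)
    {f : MvPolynomial (Fin m) R} (hf : f ≠ 0) : lmon mo f ∈ f.support := by
  unfold lmon
  rw [dif_neg hf]
  let _ := mo.lin
  exact Finset.max'_mem _ _

theorem lcoeff_ne_zero {R : Type*} [CommRing R] (mo : MonomialOrdering m)
    {f : MvPolynomial (Fin m) R} (hf : f ≠ 0) : lcoeff mo f ≠ 0 :=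
  MvPolynomial.mem_support_iff.mp (lmon_mem_support mo hf)

theorem coeff_eq_zero_of_lmon_lt {R : Type*} [CommRing R] (mo : MonomialOrdering m)
    {f : MvPolynomial (Fin m) R} {α : Fin m →₀ ℕ} (hf : f ≠ 0)
    (h : mo.lin.lt (lmon mo f) α) : f.coeff α = 0 := by
  by_contra hα
  unfold lmon at h
  rw [dif_neg hf] at h
  let _ := mo.lin
  exact ((mo.lin.lt_iff_le_not_ge _ _).mp h).2
    (Finset.le_max' _ _ (MvPolynomial.mem_support_iff.mpr hα))

/-- If `l * μ` is a least common multiple of `l` and `t`, then the cofactor `μ` divides `d`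
whenever `l = g * a` and `t = g * d` for some `g`, `a`. -/
theorem lcm_cofactor_dvd {A : Type*} [CommRing A] [IsDomain A] {l t μ g a d : A} (hl : l ≠ 0)
    (hlcm : ∀ e, l ∣ e → t ∣ e → l * μ ∣ e) (hla : l = g * a) (htd : t = g * d) : μ ∣ d := by
  have h : l * μ ∣ l * d :=
    hlcm _ (dvd_mul_right _ _) ⟨a, by rw [hla, htd]; ring⟩
  exact (mul_dvd_mul_iff_left hl).mp h

/-- The cofactor `μ` of `l` in a least common multiple of `l` and `t` is prime to any `p` whose
multiplicity in `t` is at most its multiplicity in `l`. -/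
theorem not_dvd_lcm_cofactor {K : Type*} [Field K] {l t μ p : Polynomial K}
    (hl : l ≠ 0) (ht : t ≠ 0) (hp : Irreducible p)
    (hlcm : ∀ e, l ∣ e → t ∣ e → l * μ ∣ e) (hmin : ∀ k : ℕ, p ^ k ∣ t → p ^ k ∣ l) :
    ¬ p ∣ μ := by
  obtain ⟨k, d, hd, htd⟩ := WfDvdMonoid.max_power_factor ht hp
  obtain ⟨a, ha⟩ := hmin k ⟨d, htd⟩
  exact fun h => hd (h.trans (lcm_cofactor_dvd hl hlcm ha htd))

/-- If `∑ l j = 0` and `l j * μ j = l (last) * ν j`, then any common multiple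
`B = μ j * c j` of the `μ j` satisfies `B + ∑ c j * ν j = 0`. -/
theorem add_sum_cofactor_eq_zero {A : Type*} [CommRing A] [IsDomain A] {s : ℕ}
    (l : Fin (s + 1) → A) (μ ν c : Fin s → A) (B : A) (hl : l (Fin.last s) ≠ 0)
    (hsum : ∑ j, l j = 0) (hμν : ∀ j : Fin s, l j.castSucc * μ j = l (Fin.last s) * ν j)
    (hB : ∀ j, B = μ j * c j) : B + ∑ j, c j * ν j = 0 := by
  refine (mul_eq_zero.mp ?_).resolve_left hl
  rw [Fin.sum_univ_castSucc] at hsum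
  calc l (Fin.last s) * (B + ∑ j, c j * ν j)
      = B * (∑ j : Fin s, l j.castSucc + l (Fin.last s)) := by
        rw [mul_add, mul_add, Finset.mul_sum, Finset.mul_sum, add_comm, mul_comm _ B]
        congr 1
        refine Finset.sum_congr rfl fun j _ => ?_
        rw [hB j]
        linear_combination -c j * hμν j
    _ = 0 := by rw [hsum, mul_zero]

theorem C_mul_sum_eq_sum_syzygy {σ A R : Type*} [CommRing A] [CommRing R] (φ : A →+* R) {s : ℕ}
    (f : Fin (s + 1) → MvPolynomial σ R) (μ ν c : Fin s → A) (B : A)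
    (hB : ∀ j, B = μ j * c j) (h : B + ∑ j, c j * ν j = 0) :
    C (φ B) * ∑ j, f j
      = ∑ j : Fin s, C (φ (c j)) * (C (φ (μ j)) * f j.castSucc - C (φ (ν j)) * f (Fin.last s)) := by
  have h' : (C (φ B) : MvPolynomial σ R) + ∑ j, C (φ (c j)) * C (φ (ν j)) = 0 := by
    simpa using congrArg (fun a => (C (φ a) : MvPolynomial σ R)) h
  have h₁ : ∑ j : Fin s, C (φ (c j)) * (C (φ (μ j)) * f j.castSucc - C (φ (ν j)) * f (Fin.last s))
      = C (φ B) * ∑ j : Fin s, f j.castSucc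
        - (∑ j, C (φ (c j)) * C (φ (ν j))) * f (Fin.last s) := by
    rw [Finset.mul_sum, Finset.sum_mul, ← Finset.sum_sub_distrib]
    refine Finset.sum_congr rfl fun j _ => ?_
    rw [hB j, map_mul, map_mul]
    ring
  rw [h₁, Fin.sum_univ_castSucc]
  linear_combination f (Fin.last s) * h'

/-- Syzygy lemma over the PQR `R̄ = K[x₁]/⟨q⟩`: if `f_0, …, f_s` are nonconstant
polynomials with the same leading monomial `x̃^α` and `lm(Σ f_j) ≺ x̃^α` (in particular if
the sum is zero), then, with S-polynomial multipliers `σ(μ_j), σ(ν_j)` obtained from lcm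
data for the canonical representatives of the leading coefficients,
`b·(Σ f_j) = Σ_{j<s} b_j·S(f_j, f_s)` for some nonzero `b, b_j ∈ R̄`; moreover, for every
irreducible factor `p` of `q` such that (after relabelling) the multiplicity of `p` in
`ι(lc f_s)` is minimal, `b` can be chosen so that `p` does not divide `ι(b)`. -/
theorem syzygy_spoly_expansion_PQR {K : Type*} [Field K]
    (q : Polynomial K) (hq : 0 < q.natDegree)
    (ι : (Polynomial K ⧸ Ideal.span {q}) → Polynomial K)
    (hι : ∀ x, Ideal.Quotient.mk (Ideal.span {q}) (ι x) = x ∧ (ι x).degree < q.degree)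
    (mo : MonomialOrdering m)
    (s : ℕ) (f : Fin (s + 1) → MvPolynomial (Fin m) (Polynomial K ⧸ Ideal.span {q}))
    (hfnc : ∀ j, Nonconst (f j))
    (α : Fin m →₀ ℕ) (hlm : ∀ j, lmon mo (f j) = α)
    -- lcm data for the pairs `(ι(lc (f j)), ι(lc (f s)))`
    (mm μ ν : Fin s → Polynomial K)
    (hμ : ∀ j : Fin s, ι (lcoeff mo (f j.castSucc)) * μ j = mm j)
    (hν : ∀ j : Fin s, ι (lcoeff mo (f (Fin.last s))) * ν j = mm j)
    (hlcm : ∀ (j : Fin s) (e : Polynomial K),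
      ι (lcoeff mo (f j.castSucc)) ∣ e → ι (lcoeff mo (f (Fin.last s))) ∣ e → mm j ∣ e)
    (hsum : (∑ j, f j) ≠ 0 → mo.lin.lt (lmon mo (∑ j, f j)) α) :
    (∃ (b : Polynomial K ⧸ Ideal.span {q}) (bj : Fin s → Polynomial K ⧸ Ideal.span {q}),
      b ≠ 0 ∧ (∀ j, bj j ≠ 0) ∧
      MvPolynomial.C b * (∑ j, f j)
        = ∑ j : Fin s, MvPolynomial.C (bj j) *
            (MvPolynomial.C (Ideal.Quotient.mk (Ideal.span {q}) (μ j)) * f j.castSucc -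
              MvPolynomial.C (Ideal.Quotient.mk (Ideal.span {q}) (ν j)) * f (Fin.last s))) ∧
    (∀ p : Polynomial K, Irreducible p → p ∣ q →
      (∀ (j : Fin (s + 1)) (k : ℕ),
        p ^ k ∣ ι (lcoeff mo (f (Fin.last s))) → p ^ k ∣ ι (lcoeff mo (f j))) →
      ∃ (b : Polynomial K ⧸ Ideal.span {q}) (bj : Fin s → Polynomial K ⧸ Ideal.span {q}),
        b ≠ 0 ∧ (∀ j, bj j ≠ 0) ∧ ¬ p ∣ ι b ∧
        MvPolynomial.C b * (∑ j, f j)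
          = ∑ j : Fin s, MvPolynomial.C (bj j) *
              (MvPolynomial.C (Ideal.Quotient.mk (Ideal.span {q}) (μ j)) * f j.castSucc -
                MvPolynomial.C (Ideal.Quotient.mk (Ideal.span {q}) (ν j)) *
                  f (Fin.last s))) := by
  have hq0 : q ≠ 0 := by
    rintro rfl
    simp at hq
  set l : Fin (s + 1) → Polynomial K := fun j => ι (lcoeff mo (f j)) with hl
  have hlc : ∀ j, Ideal.Quotient.mk (Ideal.span {q}) (l j) = (f j).coeff α := fun j => by
    rw [← hlm j]
    exact (hι _).1
  have hl0 : ∀ j, l j ≠ 0 := fun j h0 => by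
    have hf : f j ≠ 0 := fun h => hfnc j 0 (by rw [h, map_zero])
    apply lcoeff_ne_zero mo hf
    rw [← (hι (lcoeff mo (f j))).1]
    exact (congrArg _ h0).trans (map_zero _)
  have hmk : ∀ {a : Polynomial K}, a ≠ 0 → a.degree < q.degree →
      Ideal.Quotient.mk (Ideal.span {q}) a ≠ 0 := fun {a} ha hd h => by
    rw [Ideal.Quotient.eq_zero_iff_dvd] at h
    exact ha (Polynomial.eq_zero_of_dvd_of_degree_lt h hd)
  have hlsum : ∑ j, l j = 0 := by
    by_contra hne
    refine hmk hne ?_ ?_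
    · exact (Polynomial.degree_sum_le _ _).trans_lt
        ((Finset.sup_lt_iff (bot_lt_iff_ne_bot.mpr (Polynomial.degree_ne_bot.mpr hq0))).mpr
          fun j _ => (hι _).2)
    · rw [map_sum, Finset.sum_congr rfl fun j _ => hlc j, ← MvPolynomial.coeff_sum]
      by_cases h0 : ∑ j, f j = 0
      · rw [h0, MvPolynomial.coeff_zero]
      · exact coeff_eq_zero_of_lmon_lt mo h0 (hsum h0)
  have hlcm' : ∀ (j : Fin s) (e : Polynomial K), l j.castSucc ∣ e → l (Fin.last s) ∣ e →
      l j.castSucc * μ j ∣ e := fun j e h₁ h₂ => (hμ j).symm ▸ hlcm j e h₁ h₂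
  have hμν : ∀ j : Fin s, l j.castSucc * μ j = l (Fin.last s) * ν j :=
    fun j => (hμ j).trans (hν j).symm
  have key : ∀ (B : Polynomial K) (c : Fin s → Polynomial K), (∀ j, B = μ j * c j) → _ :=
    fun B c hB => C_mul_sum_eq_sum_syzygy (Ideal.Quotient.mk (Ideal.span {q})) f μ ν c B hB
      (add_sum_cofactor_eq_zero l μ ν c B (hl0 _) hlsum hμν hB)
  constructor
  · have hdvd : ∀ j, μ j ∣ l (Fin.last s) := fun j =>
      lcm_cofactor_dvd (hl0 _) (hlcm' j) (one_mul _).symm (one_mul _).symm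
    choose c hc using hdvd
    have hdeg : (l (Fin.last s)).degree < q.degree := (hι _).2
    refine ⟨_, fun j => Ideal.Quotient.mk (Ideal.span {q}) (c j), hmk (hl0 _) hdeg,
      fun j => hmk ?_ ?_, key _ c hc⟩
    · exact right_ne_zero_of_mul (hc j ▸ hl0 (Fin.last s))
    · exact (Polynomial.degree_le_of_dvd (Dvd.intro_left _ (hc j).symm) (hl0 _)).trans_lt hdeg
  · intro p hp hpq hmin
    have hpμ : ∀ j, ¬ p ∣ μ j := fun j =>
      not_dvd_lcm_cofactor (hl0 _) (hl0 _) hp (hlcm' j) (hmin j.castSucc)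
    have hpprod : ∀ t : Finset (Fin s), ¬ p ∣ ∏ j ∈ t, μ j := fun t h => by
      obtain ⟨j, -, hj⟩ := (hp.prime.dvd_finsetProd_iff _).mp h
      exact hpμ j hj
    have hmkp : ∀ {a : Polynomial K}, ¬ p ∣ a → Ideal.Quotient.mk (Ideal.span {q}) a ≠ 0 :=
      fun ha h => ha (hpq.trans (Ideal.Quotient.eq_zero_iff_dvd _ _ |>.mp h))
    refine ⟨_, fun j => Ideal.Quotient.mk (Ideal.span {q}) (∏ i ∈ Finset.univ.erase j, μ i),
      hmkp (hpprod Finset.univ), fun j => hmkp (hpprod _), fun h => hpprod Finset.univ ?_,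
      key _ (fun j => ∏ i ∈ Finset.univ.erase j, μ i)
        fun j => (Finset.mul_prod_erase _ _ (Finset.mem_univ j)).symm⟩
    refine (dvd_iff_dvd_of_dvd_sub (hpq.trans ?_)).mp h
    rw [← Ideal.mem_span_singleton, ← Ideal.Quotient.eq]
    exact (hι _).1
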